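/- If the integrity keys (l₁, t₁) and (l₂, t₂) are disjoint (neither is a prefix of the other and they are unequal), then for every line number l : ℕ, the keys (l₂, t₂) and (l, nextToken l₁ t₁) are also disjoint. Consequently, invoking a procedure from a call whose key is disjoint from (l₂, t₂) only creates keys disjoint from (l₂, t₂). -/

import Mathlib

/-- Tokens are lists of line numbers (simplified call stacks). -/
abbrev Token : Type := List ℕ

/-- `nextToken l t` prepends the line number `l` to the token `t`. -/
def nextToken (l : ℕ) (t : Token) : Token := l :: t

/-- The key list of an integrity key `(l, t)` is `l :: t`. -/
def KeyList (k : ℕ × Token) : List ℕ := k.1 :: k.2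

/-- `(l₁,t₁) ≺ (l₂,t₂)`: the key `(l₁,t₁)` is a prefix of the key `(l₂,t₂)`,
i.e. the list `l₁ :: t₁` is a proper suffix of the list `l₂ :: t₂`. -/
def KPre (k₁ k₂ : ℕ × Token) : Prop :=
  KeyList k₁ <:+ KeyList k₂ ∧ KeyList k₁ ≠ KeyList k₂

/-- Two keys are disjoint when neither is a prefix of the other and they are
not equal. -/
def KDisj (k₁ k₂ : ℕ × Token) : Prop :=
  ¬ KPre k₁ k₂ ∧ ¬ KPre k₂ k₁ ∧ k₁ ≠ k₂

theorem keyList_injective : Function.Injective KeyList := by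
  rintro ⟨l₁, t₁⟩ ⟨l₂, t₂⟩ h
  simpa [KeyList] using h

/-- Two keys are disjoint iff their key lists are incomparable for the suffix order. -/
theorem kDisj_iff_not_isSuffix (k₁ k₂ : ℕ × Token) :
    KDisj k₁ k₂ ↔ ¬ KeyList k₁ <:+ KeyList k₂ ∧ ¬ KeyList k₂ <:+ KeyList k₁ := by
  unfold KDisj KPre
  rw [← keyList_injective.ne_iff]
  constructor
  · rintro ⟨h₁, h₂, hne⟩
    exact ⟨fun h => h₁ ⟨h, hne⟩, fun h => h₂ ⟨h, hne.symm⟩⟩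
  · rintro ⟨h₁, h₂⟩
    exact ⟨fun h => h₁ h.1, fun h => h₂ h.1, fun h => h₁ (h ▸ List.suffix_rfl)⟩

/-- If `(l₁,t₁)` and `(l₂,t₂)` are disjoint, then for every line number `l`
the keys `(l₂,t₂)` and `(l, nextToken l₁ t₁)` are also disjoint: invoking a
procedure from a call whose key is disjoint from `(l₂,t₂)` only creates keys
disjoint from `(l₂,t₂)`. -/
theorem disjoint_nextToken (l₁ l₂ : ℕ) (t₁ t₂ : Token)
    (h : KDisj (l₁, t₁) (l₂, t₂)) (l : ℕ) :
    KDisj (l₂, t₂) (l, nextToken l₁ t₁) := by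
  rw [kDisj_iff_not_isSuffix] at h ⊢
  have hsuf : KeyList (l₁, t₁) <:+ KeyList (l, nextToken l₁ t₁) := List.suffix_cons _ _
  refine ⟨fun hs => ?_, fun hs => h.1 (hsuf.trans hs)⟩
  rcases List.suffix_cons_iff.1 hs with heq | hs
  · exact h.1 (heq ▸ hsuf)
  · exact h.2 hs
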